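/- Under the Kleinman policy iteration, the sequences converge: lim_{k→∞} P_k = P⋆ and lim_{k→∞} K_k = K⋆ = R⁻¹BᵀP⋆. -/

import Mathlib

open Matrix

noncomputable section

def Hurwitz {n : ℕ} (M : Matrix (Fin n) (Fin n) ℝ) : Prop :=
  ∀ μ ∈ spectrum ℂ (M.map Complex.ofReal), μ.re < 0

def Observable {n p : ℕ} (A : Matrix (Fin n) (Fin n) ℝ) (C : Matrix (Fin p) (Fin n) ℝ) : Prop :=
  ∀ μ : ℂ, (Matrix.fromRows (A.map Complex.ofReal - μ • 1) (C.map Complex.ofReal)).rank = n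

lemma mapRe {n p : ℕ} (A : Matrix (Fin p) (Fin n) ℝ) (w : Fin n → ℂ) :
    (fun i => ((A.map Complex.ofReal *ᵥ w) i).re) = A *ᵥ (fun i => (w i).re) := by
  funext i
  simp [mulVec, dotProduct, Complex.re_sum]

lemma mapIm {n p : ℕ} (A : Matrix (Fin p) (Fin n) ℝ) (w : Fin n → ℂ) :
    (fun i => ((A.map Complex.ofReal *ᵥ w) i).im) = A *ᵥ (fun i => (w i).im) := by
  funext i
  simp [mulVec, dotProduct, Complex.im_sum]

/-- complexification of a real subspace -/
def complexify {n : ℕ} (V : Submodule ℝ (Fin n → ℝ)) : Submodule ℂ (Fin n → ℂ) where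
  carrier := {w | (fun i => (w i).re) ∈ V ∧ (fun i => (w i).im) ∈ V}
  add_mem' := by
    rintro a b ⟨h1, h2⟩ ⟨h3, h4⟩
    exact ⟨V.add_mem h1 h3, V.add_mem h2 h4⟩
  zero_mem' := ⟨V.zero_mem, V.zero_mem⟩
  smul_mem' := by
    rintro c w ⟨h1, h2⟩
    refine ⟨?_, ?_⟩
    · have := V.sub_mem (V.smul_mem c.re h1) (V.smul_mem c.im h2)
      convert this using 1
      funext i
      simp
    · have := V.add_mem (V.smul_mem c.re h2) (V.smul_mem c.im h1)
      convert this using 1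
      funext i
      simp

lemma obs_sub {n p : ℕ} {A : Matrix (Fin n) (Fin n) ℝ} {C : Matrix (Fin p) (Fin n) ℝ}
    (hobs : Observable A C) (V : Submodule ℝ (Fin n → ℝ))
    (hA : ∀ x ∈ V, A *ᵥ x ∈ V) (hC : ∀ x ∈ V, C *ᵥ x = 0) : ∀ x ∈ V, x = 0 := by
  intro x hx
  by_contra hx0
  have hinv : ∀ w ∈ complexify V, (A.map Complex.ofReal).mulVecLin w ∈ complexify V := by
    rintro w ⟨h1, h2⟩
    refine ⟨?_, ?_⟩
    · rw [mulVecLin_apply, mapRe]; exact hA _ h1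
    · rw [mulVecLin_apply, mapIm]; exact hA _ h2
  have hmem : (fun i => (x i : ℂ)) ∈ complexify V := by
    refine ⟨?_, ?_⟩
    · simpa using hx
    · simp only [Complex.ofReal_im]
      exact V.zero_mem
  haveI : Nontrivial (complexify V) := by
    refine ⟨⟨⟨_, hmem⟩, 0, ?_⟩⟩
    intro h
    apply hx0
    have h2 := congrArg Subtype.val h
    funext i
    have h3 := congrFun h2 i
    simpa using h3
  obtain ⟨μ, hμ⟩ := Module.End.exists_eigenvalue
    (((A.map Complex.ofReal).mulVecLin).restrict hinv)
  obtain ⟨v, hv⟩ := hμ.exists_hasEigenvector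
  have hv1 := congrArg Subtype.val hv.apply_eq_smul
  have hv0 : (v : Fin n → ℂ) ≠ 0 := fun h => hv.2 (Subtype.ext h)
  simp only [LinearMap.coe_restrict_apply, mulVecLin_apply, Submodule.coe_smul] at hv1
  have hCv : C.map Complex.ofReal *ᵥ (v : Fin n → ℂ) = 0 := by
    have h1 := mapRe C v
    have h2 := mapIm C v
    rw [hC _ v.2.1] at h1
    rw [hC _ v.2.2] at h2
    funext i
    exact Complex.ext (congrFun h1 i) (congrFun h2 i)
  have hr := hobs μ
  set F := Matrix.fromRows (A.map Complex.ofReal - μ • 1) (C.map Complex.ofReal) with hF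
  have hFv : F *ᵥ (v : Fin n → ℂ) = 0 := by
    rw [hF, fromRows_mulVec, hCv, sub_mulVec, hv1, smul_mulVec, one_mulVec, sub_self]
    funext i
    cases i <;> rfl
  have hker : LinearMap.ker F.mulVecLin = ⊥ := by
    have h := LinearMap.finrank_range_add_finrank_ker F.mulVecLin
    rw [Matrix.rank] at hr
    rw [hr] at h
    simp at h
    exact h
  have : (v : Fin n → ℂ) ∈ LinearMap.ker F.mulVecLin := by
    simpa using hFv
  rw [hker] at this
  exact hv0 (by simpa using this)

lemma psd_dot {n : ℕ} {M : Matrix (Fin n) (Fin n) ℝ} (h : M.PosSemidef) (x : Fin n → ℝ) :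
    0 ≤ x ⬝ᵥ M *ᵥ x := by simpa using h.dotProduct_mulVec_nonneg x

lemma psd_zero {n : ℕ} {M : Matrix (Fin n) (Fin n) ℝ} (h : M.PosSemidef) {x : Fin n → ℝ}
    (hx : x ⬝ᵥ M *ᵥ x = 0) : M *ᵥ x = 0 := by
  apply (h.dotProduct_mulVec_zero_iff x).1
  simpa using hx

lemma psd_conj {n m : ℕ} {R : Matrix (Fin m) (Fin m) ℝ} (hR : R.PosSemidef)
    (K : Matrix (Fin m) (Fin n) ℝ) : (Kᵀ * R * K).PosSemidef := by
  simpa [conjTranspose_eq_transpose_of_trivial] using hR.conjTranspose_mul_mul_same K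

lemma ker_trivial {n m : ℕ} {A : Matrix (Fin n) (Fin n) ℝ} {B : Matrix (Fin n) (Fin m) ℝ}
    {Q C : Matrix (Fin n) (Fin n) ℝ} {R : Matrix (Fin m) (Fin m) ℝ}
    (hQ : Q.PosSemidef) (hC : Cᵀ * C = Q) (hobs : Observable A C) (hR : R.PosDef)
    (K : Matrix (Fin m) (Fin n) ℝ) {E W : Matrix (Fin n) (Fin n) ℝ} (hE : E.PosSemidef)
    (hW : W.PosSemidef) {t : ℝ} (ht : 0 < t)
    (h : E * (A - B * K) + (A - B * K)ᵀ * E = -(W + t • (Q + Kᵀ * R * K))) :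
    ∀ x, E *ᵥ x = 0 → x = 0 := by
  have hKR := psd_conj hR.posSemidef K
  have key : ∀ x, E *ᵥ x = 0 → C *ᵥ x = 0 ∧ E *ᵥ (A *ᵥ x) = 0 := by
    intro x hx
    have h1 : E *ᵥ ((A - B * K) *ᵥ x) = -(W *ᵥ x + t • (Q *ᵥ x + (Kᵀ * R * K) *ᵥ x)) := by
      have := congrArg (fun Z => Z *ᵥ x) h
      simpa [add_mulVec, neg_mulVec, smul_mulVec, ← mulVec_mulVec, hx] using this
    have hEt : Eᵀ = E := by simpa using hE.1.eq
    have h2 : x ⬝ᵥ E *ᵥ ((A - B * K) *ᵥ x) = 0 := by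
      rw [dotProduct_mulVec, ← mulVec_transpose, hEt, hx, zero_dotProduct]
    rw [h1] at h2
    simp only [dotProduct_neg, dotProduct_add, dotProduct_smul, smul_eq_mul] at h2
    have a1 := psd_dot hW x
    have a2 := psd_dot hQ x
    have a3 := psd_dot hKR x
    have b2 : x ⬝ᵥ Q *ᵥ x = 0 := by nlinarith
    have b3 : x ⬝ᵥ (Kᵀ * R * K) *ᵥ x = 0 := by nlinarith
    have b1 : x ⬝ᵥ W *ᵥ x = 0 := by rw [b2, b3] at h2; linarith
    have c1 := psd_zero hW b1
    have c2 := psd_zero hQ b2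
    have c3 := psd_zero hKR b3
    have d2 : C *ᵥ x = 0 := by
      rw [← hC, ← mulVec_mulVec, dotProduct_mulVec, ← mulVec_transpose, transpose_transpose] at b2
      exact dotProduct_self_eq_zero.1 b2
    have d3 : K *ᵥ x = 0 := by
      by_contra hne
      have := hR.dotProduct_mulVec_pos hne
      rw [← mulVec_mulVec, ← mulVec_mulVec, dotProduct_mulVec, ← mulVec_transpose,
        transpose_transpose] at b3
      simp only [star_trivial] at this
      linarith
    refine ⟨d2, ?_⟩
    rw [c1, c2, c3, sub_mulVec, ← mulVec_mulVec, d3] at h1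
    simpa using h1
  intro x hx
  exact obs_sub hobs (LinearMap.ker E.mulVecLin)
    (fun y hy => by simpa using (key y (by simpa using hy)).2)
    (fun y hy => (key y (by simpa using hy)).1) x (by simpa using hx)

lemma exists_min {n : ℕ} {D P : Matrix (Fin n) (Fin n) ℝ} (hn : ∃ x : Fin n → ℝ, x ≠ 0)
    (hP : ∀ x, x ≠ 0 → 0 < x ⬝ᵥ P *ᵥ x) :
    ∃ (v : Fin n → ℝ) (c : ℝ), v ≠ 0 ∧ v ⬝ᵥ D *ᵥ v = c * (v ⬝ᵥ P *ᵥ v) ∧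
      ∀ x, c * (x ⬝ᵥ P *ᵥ x) ≤ x ⬝ᵥ D *ᵥ x := by
  obtain ⟨x0, hx0⟩ := hn
  have hcont : ∀ M : Matrix (Fin n) (Fin n) ℝ, Continuous (fun x : Fin n → ℝ => x ⬝ᵥ M *ᵥ x) := by
    intro M
    exact continuous_id.dotProduct (continuous_const.matrix_mulVec continuous_id)
  have hsphere : ∀ x : Fin n → ℝ, x ≠ 0 → ‖x‖⁻¹ • x ∈ Metric.sphere (0 : Fin n → ℝ) 1 := by
    intro x hx
    simp [norm_smul, hx]
  have hne : ∀ x ∈ Metric.sphere (0 : Fin n → ℝ) 1, x ≠ 0 := by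
    rintro x hx rfl
    simp at hx
  obtain ⟨v, hv, hmin⟩ := (isCompact_sphere (0 : Fin n → ℝ) 1).exists_isMinOn ⟨_, hsphere x0 hx0⟩
    (f := fun x => (x ⬝ᵥ D *ᵥ x) / (x ⬝ᵥ P *ᵥ x))
    ((hcont D).continuousOn.div (hcont P).continuousOn (fun x hx => (hP x (hne x hx)).ne'))
  refine ⟨v, (v ⬝ᵥ D *ᵥ v) / (v ⬝ᵥ P *ᵥ v), hne v hv, ?_, ?_⟩
  · rw [div_mul_cancel₀ _ (hP v (hne v hv)).ne']
  · intro x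
    by_cases hx : x = 0
    · simp [hx]
    have h := hmin (hsphere x hx)
    simp only [Set.mem_setOf_eq, mulVec_smul, dotProduct_smul, smul_dotProduct, smul_eq_mul] at h
    have hx' : ‖x‖⁻¹ ≠ 0 := inv_ne_zero (norm_ne_zero_iff.2 hx)
    rw [mul_div_mul_left _ _ hx', mul_div_mul_left _ _ hx'] at h
    rwa [le_div_iff₀ (hP x hx)] at h

lemma core {n m : ℕ} {A : Matrix (Fin n) (Fin n) ℝ} {B : Matrix (Fin n) (Fin m) ℝ}
    {Q C : Matrix (Fin n) (Fin n) ℝ} {R : Matrix (Fin m) (Fin m) ℝ}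
    (hQ : Q.PosSemidef) (hC : Cᵀ * C = Q) (hobs : Observable A C) (hR : R.PosDef)
    (K : Matrix (Fin m) (Fin n) ℝ) {P D W : Matrix (Fin n) (Fin n) ℝ} (hP : P.PosSemidef)
    (hPL : P * (A - B * K) + (A - B * K)ᵀ * P + Q + Kᵀ * R * K = 0)
    (hD : Dᵀ = D) (hW : W.PosSemidef)
    (h : D * (A - B * K) + (A - B * K)ᵀ * D = -W) : D.PosSemidef := by
  have hPL' : P * (A - B * K) + (A - B * K)ᵀ * P = -(Q + Kᵀ * R * K) := by
    rw [add_assoc] at hPL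
    exact eq_neg_of_add_eq_zero_left hPL
  have hPpos : ∀ x, x ≠ 0 → 0 < x ⬝ᵥ P *ᵥ x := by
    intro x hx
    refine lt_of_le_of_ne (psd_dot hP x) fun h0 => hx ?_
    refine ker_trivial (B := B) hQ hC hobs hR K hP (W := 0) .zero (t := 1) one_pos ?_ x (psd_zero hP h0.symm)
    rw [hPL']; simp
  have hDH : D.IsHermitian := by simpa [IsHermitian] using hD
  refine PosSemidef.of_dotProduct_mulVec_nonneg hDH fun x => ?_
  simp only [star_trivial]
  by_cases hx : x = 0
  · simp [hx]
  obtain ⟨v, c, hv0, hvc, hmin⟩ := exists_min (D := D) ⟨x, hx⟩ hPpos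
  by_cases hc : 0 ≤ c
  · exact le_trans (mul_nonneg hc (psd_dot hP x)) (hmin x)
  exfalso
  push Not at hc
  have hE : (D + (-c) • P).PosSemidef := by
    refine PosSemidef.of_dotProduct_mulVec_nonneg ?_ fun y => ?_
    · have := hP.1.eq
      simp only [conjTranspose_eq_transpose_of_trivial] at this
      simp [IsHermitian, hD, this]
    · have := hmin y
      simp only [star_trivial, add_mulVec, smul_mulVec, dotProduct_add, dotProduct_smul,
        smul_eq_mul]
      linarith
  refine hv0 (ker_trivial (B := B) hQ hC hobs hR K hE hW (t := -c) (by linarith) ?_ v (psd_zero hE ?_))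
  · rw [neg_add, ← h, ← smul_neg, ← hPL']
    simp only [Matrix.add_mul, Matrix.mul_add, Matrix.smul_mul, Matrix.mul_smul, smul_add]
    abel
  · simp only [add_mulVec, smul_mulVec, dotProduct_add, dotProduct_smul, smul_eq_mul]
    linarith

/-- Lyapunov residual -/
def lyap {n m : ℕ} (A : Matrix (Fin n) (Fin n) ℝ) (B : Matrix (Fin n) (Fin m) ℝ)
    (Q : Matrix (Fin n) (Fin n) ℝ) (R : Matrix (Fin m) (Fin m) ℝ)
    (P : Matrix (Fin n) (Fin n) ℝ) (K : Matrix (Fin m) (Fin n) ℝ) : Matrix (Fin n) (Fin n) ℝ :=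
  P * (A - B * K) + (A - B * K)ᵀ * P + Q + Kᵀ * R * K

lemma lyap_square {n m : ℕ} (A : Matrix (Fin n) (Fin n) ℝ) (B : Matrix (Fin n) (Fin m) ℝ)
    (Q : Matrix (Fin n) (Fin n) ℝ) {R : Matrix (Fin m) (Fin m) ℝ} (hR : R.PosDef)
    {X : Matrix (Fin n) (Fin n) ℝ} (hX : Xᵀ = X) (K : Matrix (Fin m) (Fin n) ℝ) :
    lyap A B Q R X K = lyap A B Q R X (R⁻¹ * Bᵀ * X) +
      (K - R⁻¹ * Bᵀ * X)ᵀ * R * (K - R⁻¹ * Bᵀ * X) := by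
  have hRt : Rᵀ = R := by simpa using hR.1.eq
  have hu : IsUnit R.det := (isUnit_iff_isUnit_det R).1 hR.isUnit
  have h1 : R * (R⁻¹ * Bᵀ * X) = Bᵀ * X := by
    rw [Matrix.mul_assoc, mul_nonsing_inv_cancel_left _ _ hu]
  generalize R⁻¹ * Bᵀ * X = L at *
  have h2 : Lᵀ * R = X * B := by
    have := congrArg transpose h1
    simpa [transpose_mul, hRt, hX] using this
  simp only [lyap, transpose_sub, transpose_mul, Matrix.mul_sub, Matrix.sub_mul, Matrix.mul_assoc, h1]
  have h3 : ∀ Y : Matrix (Fin m) (Fin n) ℝ, Lᵀ * (R * Y) = X * (B * Y) := by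
    intro Y; rw [← Matrix.mul_assoc, h2, Matrix.mul_assoc]
  have h4 : Lᵀ * (Bᵀ * X) = X * (B * L) := by rw [← h1, h3]
  simp only [h3, h4]
  abel

lemma quad_entry {n : ℕ} {M : Matrix (Fin n) (Fin n) ℝ} (hM : Mᵀ = M) (i j : Fin n) :
    M i j = ((Pi.single i 1 + Pi.single j 1) ⬝ᵥ M *ᵥ (Pi.single i 1 + Pi.single j 1)
      - Pi.single i 1 ⬝ᵥ M *ᵥ Pi.single i 1 - Pi.single j 1 ⬝ᵥ M *ᵥ Pi.single j 1) / 2 := by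
  have : M j i = M i j := congrFun (congrFun hM i) j
  simp [mulVec_add, add_dotProduct, dotProduct_add, this]
  ring

lemma seq_conv {n m : ℕ} {A : Matrix (Fin n) (Fin n) ℝ} {B : Matrix (Fin n) (Fin m) ℝ}
    {Q C : Matrix (Fin n) (Fin n) ℝ} {R : Matrix (Fin m) (Fin m) ℝ}
    (hQ : Q.PosSemidef) (hC : Cᵀ * C = Q) (hobs : Observable A C) (hR : R.PosDef)
    {X : Matrix (Fin n) (Fin n) ℝ} (hX : X.PosSemidef)
    (hXL : lyap A B Q R X (R⁻¹ * Bᵀ * X) = 0)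
    (S : ℕ → Matrix (Fin n) (Fin n) ℝ) (L : ℕ → Matrix (Fin m) (Fin n) ℝ)
    (hS : ∀ j, (S j).PosSemidef) (hSL : ∀ j, lyap A B Q R (S j) (L j) = 0)
    (hL : ∀ j, L (j + 1) = R⁻¹ * Bᵀ * S j) :
    Filter.Tendsto S Filter.atTop (nhds X) := by
  have sym : ∀ {M : Matrix (Fin n) (Fin n) ℝ}, M.PosSemidef → Mᵀ = M := by
    intro M hM; simpa using hM.1.eq
  -- comparison
  have diff : ∀ (P D : Matrix (Fin n) (Fin n) ℝ) (K : Matrix (Fin m) (Fin n) ℝ),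
      (P - D) * (A - B * K) + (A - B * K)ᵀ * (P - D) = lyap A B Q R P K - lyap A B Q R D K := by
    intro P D K
    simp only [lyap, Matrix.sub_mul P D, Matrix.mul_sub _ P D]
    abel
  have comp : ∀ (P Y : Matrix (Fin n) (Fin n) ℝ) (K : Matrix (Fin m) (Fin n) ℝ), P.PosSemidef →
      lyap A B Q R P K = 0 → Yᵀ = Y → lyap A B Q R Y (R⁻¹ * Bᵀ * Y) = 0 → (P - Y).PosSemidef := by
    intro P Y K hP hPK hY hYL
    refine core hQ hC hobs hR K hP hPK (by simp [sym hP, hY])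
      (psd_conj hR.posSemidef (K - R⁻¹ * Bᵀ * Y)) ?_
    rw [diff, hPK, lyap_square A B Q hR hY K, hYL]
    simp
  have mono : ∀ j, (S j - S (j + 1)).PosSemidef := by
    intro j
    refine core hQ hC hobs hR (L (j + 1)) (hS (j + 1)) (hSL (j + 1))
      (by simp [sym (hS _)]) (psd_conj hR.posSemidef (L j - R⁻¹ * Bᵀ * S j)) ?_
    rw [diff, hSL (j + 1), hL, sub_zero]
    have := hSL j
    rw [lyap_square A B Q hR (sym (hS j))] at this
    exact eq_neg_of_add_eq_zero_left this
  have hconv : ∀ x : Fin n → ℝ, ∃ l, Filter.Tendsto (fun j => x ⬝ᵥ S j *ᵥ x) Filter.atTop (nhds l) := by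
    intro x
    refine ⟨_, tendsto_atTop_ciInf (antitone_nat_of_succ_le fun j => ?_) ⟨0, ?_⟩⟩
    · have := psd_dot (mono j) x
      rw [sub_mulVec, dotProduct_sub] at this
      linarith
    · rintro _ ⟨j, rfl⟩
      exact psd_dot (hS j) x
  choose q hq using hconv
  obtain ⟨Y, hY⟩ : ∃ Y, Filter.Tendsto S Filter.atTop (nhds Y) := by
    refine ⟨fun i j => (q (Pi.single i 1 + Pi.single j 1) - q (Pi.single i 1)
      - q (Pi.single j 1)) / 2, ?_⟩
    refine tendsto_pi_nhds.2 fun i => tendsto_pi_nhds.2 fun j => ?_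
    have := (((hq (Pi.single i 1 + Pi.single j 1)).sub (hq (Pi.single i 1))).sub
      (hq (Pi.single j 1))).div_const 2
    refine this.congr fun k => ?_
    exact (quad_entry (sym (hS k)) i j).symm
  have hYs : Yᵀ = Y := by
    have h1 : Filter.Tendsto (fun k => (S k)ᵀ) Filter.atTop (nhds Yᵀ) :=
      ((continuous_id.matrix_transpose).tendsto Y).comp hY
    refine tendsto_nhds_unique (h1.congr fun k => sym (hS k)) hY
  have hYL : lyap A B Q R Y (R⁻¹ * Bᵀ * Y) = 0 := by
    have hc : Continuous (fun p : Matrix (Fin n) (Fin n) ℝ × Matrix (Fin n) (Fin n) ℝ =>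
        lyap A B Q R p.1 (R⁻¹ * Bᵀ * p.2)) := by
      unfold lyap
      fun_prop
    have h1 := (hc.tendsto (Y, Y)).comp
      ((hY.comp (Filter.tendsto_add_atTop_nat 1)).prodMk_nhds hY)
    refine tendsto_nhds_unique h1 (tendsto_const_nhds.congr fun j => ?_)
    have := hSL (j + 1)
    rw [hL] at this
    exact this.symm
  have hle : ∀ x : Fin n → ℝ, 0 ≤ x ⬝ᵥ (Y - X) *ᵥ x := by
    intro x
    have hc : Continuous (fun M : Matrix (Fin n) (Fin n) ℝ => x ⬝ᵥ (M - X) *ᵥ x) := by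
      fun_prop
    refine ge_of_tendsto' ((hc.tendsto Y).comp hY) fun j => ?_
    exact psd_dot (comp (S j) X (L j) (hS j) (hSL j) (sym hX) hXL) x
  have hge := comp X Y _ hX hXL hYs hYL
  have hXY : Y - X = 0 := by
    have h0 : ∀ x : Fin n → ℝ, x ⬝ᵥ (Y - X) *ᵥ x = 0 := by
      intro x
      have h1 := hle x
      have h2 := psd_dot hge x
      rw [sub_mulVec, dotProduct_sub] at h1 h2 ⊢
      linarith
    ext i j
    have h3 := quad_entry (M := Y - X) (by simp [hYs, sym hX]) i j
    rw [h0, h0, h0] at h3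
    simpa using h3
  rw [sub_eq_zero] at hXY
  rwa [← hXY]

theorem kleinman_convergence {n m : ℕ}
    (A : Matrix (Fin n) (Fin n) ℝ) (B : Matrix (Fin n) (Fin m) ℝ)
    (Q sqrtQ : Matrix (Fin n) (Fin n) ℝ) (R : Matrix (Fin m) (Fin m) ℝ)
    (K : ℕ → Matrix (Fin m) (Fin n) ℝ) (P : ℕ → Matrix (Fin n) (Fin n) ℝ)
    (Pstar : Matrix (Fin n) (Fin n) ℝ)
    (hstab : ∃ K₀ : Matrix (Fin m) (Fin n) ℝ, Hurwitz (A - B * K₀))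
    (hQ : Q.PosSemidef) (hsqrt : sqrtQᵀ * sqrtQ = Q)
    (hobs : Observable A sqrtQ)
    (hR : R.PosDef)
    (hK0 : Hurwitz (A - B * K 0))
    (hPstar : Pstar.PosSemidef ∧
      Aᵀ * Pstar + Pstar * A + Q - Pstar * B * R⁻¹ * Bᵀ * Pstar = 0 ∧
      Hurwitz (A - B * (R⁻¹ * Bᵀ * Pstar)))
    (hP : ∀ k, 1 ≤ k → (P k).PosDef ∧
      P k * (A - B * K (k - 1)) + (A - B * K (k - 1))ᵀ * P k
        + Q + (K (k - 1))ᵀ * R * K (k - 1) = 0)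
    (hK : ∀ k, 1 ≤ k → K k = R⁻¹ * Bᵀ * P (k - 1)) :
    Filter.Tendsto P Filter.atTop (nhds Pstar) ∧
      Filter.Tendsto K Filter.atTop (nhds (R⁻¹ * Bᵀ * Pstar)) := by
  have hXL : lyap A B Q R Pstar (R⁻¹ * Bᵀ * Pstar) = 0 := by
    obtain ⟨h1, h2, -⟩ := hPstar
    have hXt : Pstarᵀ = Pstar := by simpa using h1.1.eq
    have hRt : Rᵀ = R := by simpa using hR.1.eq
    have hu : IsUnit R.det := (isUnit_iff_isUnit_det R).1 hR.isUnit
    rw [← h2]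
    simp only [lyap, transpose_sub, transpose_mul, transpose_transpose, transpose_nonsing_inv, hRt,
      hXt, Matrix.mul_sub, Matrix.sub_mul, Matrix.mul_assoc]
    rw [mul_nonsing_inv_cancel_left _ _ hu]
    abel
  have hsub : ∀ a, 1 ≤ a → Filter.Tendsto (fun j => P (2 * j + a)) Filter.atTop (nhds Pstar) := by
    intro a ha
    refine seq_conv hQ hsqrt hobs hR hPstar.1 hXL _ (fun j => K (2 * j + a - 1))
      (fun j => (hP (2 * j + a) (by omega)).1.posSemidef)
      (fun j => (hP (2 * j + a) (by omega)).2) (fun j => ?_)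
    have := hK (2 * (j + 1) + a - 1) (by omega)
    rwa [show 2 * (j + 1) + a - 1 - 1 = 2 * j + a by omega] at this
  have hPc : Filter.Tendsto P Filter.atTop (nhds Pstar) := by
    rw [Filter.tendsto_def]
    intro s hs
    obtain ⟨N1, h1⟩ := Filter.mem_atTop_sets.1 (hsub 1 le_rfl hs)
    obtain ⟨N2, h2⟩ := Filter.mem_atTop_sets.1 (hsub 2 (by norm_num) hs)
    refine Filter.mem_atTop_sets.2 ⟨2 * (N1 + N2) + 2, fun k hk => ?_⟩
    rcases Nat.even_or_odd' k with ⟨c, rfl | rfl⟩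
    · have := h2 (c - 1) (by omega)
      simp only [Set.mem_preimage] at this ⊢
      rwa [show 2 * (c - 1) + 2 = 2 * c by omega] at this
    · exact h1 c (by omega)
  refine ⟨hPc, ?_⟩
  rw [← Filter.tendsto_add_atTop_iff_nat 1]
  have hc : Continuous (fun M : Matrix (Fin n) (Fin n) ℝ => R⁻¹ * Bᵀ * M) := by fun_prop
  refine ((hc.tendsto Pstar).comp hPc).congr fun k => ?_
  exact (hK (k + 1) (by omega)).symm
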